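/- arXiv:1306.1179 — 4 statements merged into one kernel-verified Lean document; each statement's English description precedes it below -/
import Mathlib

section
/- Let N ≥ 1, β > 0, and let V : ℝ → ℝ be a polynomial of even degree 2m (m ≥ 1) whose leading coefficient is strictly positive. Then the function λ ↦ exp(−β N H_N(λ)) is Lebesgue-integrable over the Weyl chamber W_N; that is, the partition function ∫_{W_N} e^{−β N H_N(λ)} dλ is finite. -/
open Finset MeasureTheory

/-- The Coulomb gas Hamiltonian
`H_N(λ) = (1/2)·Σ_k V(λ_k) − (1/N)·Σ_{j<k} log(λ_k − λ_j)`. -/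
noncomputable def coulombHamiltonian (N : ℕ) (V : ℝ → ℝ) (lam : Fin N → ℝ) : ℝ :=
  (1 / 2) * ∑ k, V (lam k)
    - (1 / (N : ℝ)) * ∑ j, ∑ k ∈ Finset.Ioi j, Real.log (lam k - lam j)

/-- A polynomial of degree at least two with positive leading coefficient dominates every
linear function on the nonnegative half-line, up to a constant. -/
theorem Polynomial.exists_linear_sub_const_le_eval (P : Polynomial ℝ) (hdeg : 2 ≤ P.natDegree)
    (hlead : 0 < P.leadingCoeff) (A : ℝ) :
    ∃ C : ℝ, ∀ x : ℝ, 0 ≤ x → A * x - C ≤ P.eval x := by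
  set Q : Polynomial ℝ := P - Polynomial.C A * Polynomial.X with hQ
  have hlin : (Polynomial.C A * Polynomial.X : Polynomial ℝ).degree < P.degree := by
    refine (Polynomial.degree_C_mul_X_le A).trans_lt (lt_of_not_ge fun h => ?_)
    have := Polynomial.natDegree_le_of_degree_le (n := 1) (by exact_mod_cast h)
    omega
  have hdegQ : Q.degree = P.degree := Polynomial.degree_sub_eq_left_of_degree_lt hlin
  have hleadQ : Q.leadingCoeff = P.leadingCoeff := Polynomial.leadingCoeff_sub_of_degree_lt hlin
  have htend := Q.tendsto_atTop_of_leadingCoeff_nonneg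
    (by rw [hdegQ]; exact Polynomial.natDegree_pos_iff_degree_pos.mp (by omega))
    (by rw [hleadQ]; exact hlead.le)
  obtain ⟨R, hR⟩ := Filter.eventually_atTop.mp (htend.eventually_ge_atTop 0)
  obtain ⟨B, hB⟩ := (isCompact_Icc (a := (0 : ℝ)) (b := R)).bddBelow_image
    (f := fun x => Q.eval x) Q.continuous.continuousOn
  refine ⟨max 0 (-B), fun x hx => ?_⟩
  have hQx : Q.eval x = P.eval x - A * x := by simp [hQ]
  rcases le_total R x with h | h
  · linarith [hR x h, le_max_left 0 (-B)]
  · have := hB ⟨x, ⟨hx, h⟩, rfl⟩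
    simp only at this
    linarith [le_max_right 0 (-B)]

/-- A polynomial of even degree at least two with positive leading coefficient dominates
every multiple of the absolute value, up to a constant. -/
theorem Polynomial.exists_mul_abs_sub_const_le_eval (P : Polynomial ℝ) (hdeg : 2 ≤ P.natDegree)
    (heven : Even P.natDegree) (hlead : 0 < P.leadingCoeff) (A : ℝ) :
    ∃ C : ℝ, ∀ x : ℝ, A * |x| - C ≤ P.eval x := by
  obtain ⟨C₁, h₁⟩ := P.exists_linear_sub_const_le_eval hdeg hlead A
  obtain ⟨C₂, h₂⟩ := (P.comp (-Polynomial.X)).exists_linear_sub_const_le_eval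
    (by simpa [Polynomial.natDegree_comp] using hdeg)
    (by
      rw [Polynomial.leadingCoeff_comp (by simp), Polynomial.leadingCoeff_neg,
        Polynomial.leadingCoeff_X, heven.neg_one_pow, mul_one]
      exact hlead) A
  refine ⟨max C₁ C₂, fun x => ?_⟩
  rcases le_total 0 x with h | h
  · rw [abs_of_nonneg h]
    linarith [h₁ x h, le_max_left C₁ C₂]
  · rw [abs_of_nonpos h]
    have := h₂ (-x) (by linarith)
    simp only [Polynomial.eval_comp, Polynomial.eval_neg, Polynomial.eval_X, neg_neg] at this
    linarith [le_max_right C₁ C₂]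

theorem integrable_exp_neg_abs : Integrable fun x : ℝ => Real.exp (-|x|) := by
  rw [← integrableOn_univ, ← Set.Iic_union_Ioi (a := (0 : ℝ))]
  refine IntegrableOn.union ?_ ?_
  · refine (integrableOn_exp_mul_Iic one_pos 0).congr_fun (fun x hx => ?_) measurableSet_Iic
    simp [abs_of_nonpos (Set.mem_Iic.mp hx)]
  · refine (integrableOn_exp_neg_Ioi 0).congr_fun (fun x hx => ?_) measurableSet_Ioi
    simp [abs_of_pos (Set.mem_Ioi.mp hx)]

theorem measurableSet_strictMono (N : ℕ) :
    MeasurableSet {lam : Fin N → ℝ | StrictMono lam} := by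
  have h : {lam : Fin N → ℝ | StrictMono lam} =
      ⋂ i, ⋂ j, ⋂ _ : i < j, {lam : Fin N → ℝ | lam i < lam j} := by
    ext lam
    simp [StrictMono]
  rw [h]
  exact MeasurableSet.iInter fun i => MeasurableSet.iInter fun j => MeasurableSet.iInter fun _ =>
    measurableSet_lt (measurable_pi_apply i) (measurable_pi_apply j)

theorem sum_log_sub_le {N : ℕ} {lam : Fin N → ℝ} (hlam : StrictMono lam) :
    ∑ j, ∑ k ∈ Finset.Ioi j, Real.log (lam k - lam j) ≤ 2 * N * ∑ k, |lam k| := by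
  calc ∑ j, ∑ k ∈ Finset.Ioi j, Real.log (lam k - lam j)
      ≤ ∑ j, ∑ k ∈ Finset.Ioi j, (|lam k| + |lam j|) := by
        refine Finset.sum_le_sum fun j _ => Finset.sum_le_sum fun k hk => ?_
        have hpos : 0 < lam k - lam j := sub_pos.mpr (hlam (Finset.mem_Ioi.mp hk))
        linarith [Real.log_le_sub_one_of_pos hpos, le_abs_self (lam k), neg_abs_le (lam j)]
    _ ≤ ∑ j, ∑ k, (|lam k| + |lam j|) :=
        Finset.sum_le_sum fun j _ => Finset.sum_le_sum_of_subset_of_nonneg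
          (Finset.subset_univ _) fun _ _ _ => by positivity
    _ = 2 * N * ∑ k, |lam k| := by
        simp only [Finset.sum_add_distrib, Finset.sum_const, Finset.card_univ, Fintype.card_fin,
          nsmul_eq_mul, ← Finset.mul_sum]
        ring

/-- For a polynomial potential of even degree `2m` with positive leading coefficient,
the Gibbs density `e^{−βN H_N}` is integrable over the Weyl chamber: the partition
function is finite. -/
theorem stmt_3 (N : ℕ) (hN : 1 ≤ N) (β : ℝ) (hβ : 0 < β)
    (P : Polynomial ℝ) (m : ℕ) (hm : 1 ≤ m) (hdeg : P.natDegree = 2 * m)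
    (hlead : 0 < P.leadingCoeff) :
    IntegrableOn
      (fun lam : Fin N → ℝ =>
        Real.exp (-(β * N * coulombHamiltonian N (fun x => P.eval x) lam)))
      {lam : Fin N → ℝ | StrictMono lam} := by
  have hNpos : (0 : ℝ) < N := by exact_mod_cast hN
  have hβN : 0 < β * N := by positivity
  obtain ⟨C, hC⟩ := P.exists_mul_abs_sub_const_le_eval (by omega) (by rw [hdeg]; simp) hlead
    (2 * (2 * β * N + 1) / (β * N))
  have hbound : Integrable fun lam : Fin N → ℝ =>
      ∏ k, (Real.exp (β * N / 2 * C) * Real.exp (-|lam k|)) :=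
    Integrable.fintype_prod fun _ => integrable_exp_neg_abs.const_mul _
  refine hbound.integrableOn.mono' ?_ ?_
  · refine Measurable.aestronglyMeasurable ?_
    have hP : Measurable fun x : ℝ => P.eval x := P.continuous.measurable
    unfold coulombHamiltonian
    fun_prop
  · refine (ae_restrict_iff' (measurableSet_strictMono N)).mpr (ae_of_all _ fun lam hlam => ?_)
    rw [Real.norm_of_nonneg (Real.exp_pos _).le]
    simp only [← Real.exp_add]
    rw [← Real.exp_sum, Real.exp_le_exp]
    have hsplit : -(β * N * coulombHamiltonian N (fun x => P.eval x) lam) =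
        β * ∑ j, ∑ k ∈ Finset.Ioi j, Real.log (lam k - lam j)
          - ∑ k, β * N / 2 * P.eval (lam k) := by
      rw [coulombHamiltonian, ← Finset.mul_sum]
      field_simp
      ring
    have hpot : ∑ k, ((2 * β * N + 1) * |lam k| - β * N / 2 * C) ≤
        ∑ k, β * N / 2 * P.eval (lam k) := by
      refine Finset.sum_le_sum fun k _ => ?_
      have h := mul_le_mul_of_nonneg_left (hC (lam k)) (half_pos hβN).le
      refine le_trans (le_of_eq ?_) h
      field_simp
    have hlog := mul_le_mul_of_nonneg_left (sum_log_sub_le hlam) hβ.le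
    rw [hsplit]
    simp only [Finset.sum_sub_distrib, Finset.sum_add_distrib, Finset.sum_neg_distrib,
      ← Finset.mul_sum] at hpot hlog ⊢
    linarith
end

section
/- Let g > 0 and a = sqrt((sqrt(1 + 12g) − 1)/(6g)), and define ρ(s) = (1/(2π))·(1 + 2g·a² + g·s²)·sqrt(4a² − s²) for |s| ≤ 2a and ρ(s) = 0 otherwise. Then ρ is nonnegative and ∫_{−2a}^{2a} ρ(s) ds = 1; that is, ρ is a probability density on ℝ. -/
open Real

/-- Integral of an even quadratic polynomial against the semicircle of radius `c`. -/
theorem integral_quadratic_mul_sqrt_sq_sub_sq (A g c : ℝ) (hc : 0 ≤ c) :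
    ∫ s in (-c)..c, (A + g * s ^ 2) * √(c ^ 2 - s ^ 2)
      = π * (A * c ^ 2 / 2 + g * c ^ 4 / 8) := by
  have hsubst : ∫ θ in (-(π / 2))..(π / 2),
      ((fun s => (A + g * s ^ 2) * √(c ^ 2 - s ^ 2)) ∘ fun θ => c * sin θ) θ * (c * cos θ)
      = ∫ s in (c * sin (-(π / 2)))..(c * sin (π / 2)), (A + g * s ^ 2) * √(c ^ 2 - s ^ 2) :=
    intervalIntegral.integral_comp_mul_deriv
      (fun θ _ => (hasDerivAt_sin θ).const_mul c) (by fun_prop) (by fun_prop)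
  have htrig : ∫ θ in (-(π / 2))..(π / 2),
      ((fun s => (A + g * s ^ 2) * √(c ^ 2 - s ^ 2)) ∘ fun θ => c * sin θ) θ * (c * cos θ)
      = ∫ θ in (-(π / 2))..(π / 2),
        (A * c ^ 2 * cos θ ^ 2 + g * c ^ 4 * (sin θ ^ 2 * cos θ ^ 2)) := by
    refine intervalIntegral.integral_congr fun θ hθ => ?_
    rw [Set.uIcc_of_le (by linarith [pi_pos])] at hθ
    have hsq : c ^ 2 - (c * sin θ) ^ 2 = (c * cos θ) ^ 2 := by
      linear_combination (-c ^ 2) * sin_sq_add_cos_sq θ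
    simp only [Function.comp_apply]
    rw [hsq, sqrt_sq (mul_nonneg hc (cos_nonneg_of_mem_Icc hθ))]
    ring
  rw [sin_neg, sin_pi_div_two, mul_neg, mul_one, htrig] at hsubst
  rw [← hsubst, intervalIntegral.integral_add
    (Continuous.intervalIntegrable (by fun_prop) _ _)
    (Continuous.intervalIntegrable (by fun_prop) _ _),
    intervalIntegral.integral_const_mul, intervalIntegral.integral_const_mul,
    integral_cos_sq, integral_sin_sq_mul_cos_sq]
  have h₁ : sin (4 * (π / 2)) = 0 := by
    rw [show 4 * (π / 2) = 2 * π by ring, sin_two_pi]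
  have h₂ : sin (4 * -(π / 2)) = 0 := by
    rw [show 4 * -(π / 2) = -(2 * π) by ring, sin_neg, sin_two_pi, neg_zero]
  rw [h₁, h₂, cos_neg, cos_pi_div_two]
  ring

/-- For `g > 0` and `a = sqrt((sqrt(1+12g) − 1)/(6g))`, the quartic equilibrium
density `ρ(s) = (1/(2π))(1 + 2ga² + gs²)√(4a² − s²)·1_{|s|≤2a}` is nonnegative and
integrates to `1` over `[−2a, 2a]`. -/
theorem stmt_9 (g : ℝ) (hg : 0 < g)
    (a : ℝ) (ha : a = Real.sqrt ((Real.sqrt (1 + 12 * g) - 1) / (6 * g)))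
    (ρ : ℝ → ℝ)
    (hρ : ρ = fun s =>
      if |s| ≤ 2 * a then
        (1 / (2 * π)) * (1 + 2 * g * a ^ 2 + g * s ^ 2) * Real.sqrt (4 * a ^ 2 - s ^ 2)
      else 0) :
    (∀ s, 0 ≤ ρ s) ∧ ∫ s in (-(2 * a))..(2 * a), ρ s = 1 := by
  have hroot : 1 < √(1 + 12 * g) := by
    rw [lt_sqrt] <;> linarith
  have ha0 : 0 ≤ a := ha ▸ sqrt_nonneg _
  have hasq : a ^ 2 = (√(1 + 12 * g) - 1) / (6 * g) := by
    rw [ha, sq_sqrt]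
    exact div_nonneg (by linarith) (by linarith)
  have hquad : a ^ 2 + 3 * g * a ^ 4 = 1 := by
    have h : √(1 + 12 * g) = 6 * g * a ^ 2 + 1 := by
      rw [hasq]
      field_simp
      ring
    have hsq := sq_sqrt (show 0 ≤ 1 + 12 * g by linarith)
    rw [h] at hsq
    have : 12 * g * (a ^ 2 + 3 * g * a ^ 4) = 12 * g * 1 := by linear_combination hsq
    exact mul_left_cancel₀ (by positivity) this
  refine ⟨fun s => ?_, ?_⟩
  · simp only [hρ]
    split_ifs
    · positivity
    · exact le_rfl
  · have hcongr : ∫ s in (-(2 * a))..(2 * a), ρ s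
        = ∫ s in (-(2 * a))..(2 * a), (1 / (2 * π)) *
          ((1 + 2 * g * a ^ 2 + g * s ^ 2) * √((2 * a) ^ 2 - s ^ 2)) := by
      refine intervalIntegral.integral_congr fun s hs => ?_
      rw [Set.uIcc_of_le (by linarith)] at hs
      simp only [hρ]
      rw [if_pos (abs_le.2 hs), show (2 * a) ^ 2 = 4 * a ^ 2 by ring, mul_assoc]
    rw [hcongr, intervalIntegral.integral_const_mul,
      integral_quadratic_mul_sqrt_sq_sub_sq _ _ _ (by linarith)]
    have hpi := pi_ne_zero
    field_simp
    linear_combination 8 * hquad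
end

section
/- Let N ≥ 1, let V : ℝ → ℝ, let π_0, ..., π_{N−1} be monic real polynomials with deg π_k = k, let c_0, ..., c_{N−1} be strictly positive real numbers, set φ_k(s) = c_k^{−1}·e^{−N·V(s)/2}·π_k(s) and K_N(r,s) = Σ_{k=0}^{N−1} φ_k(r)·φ_k(s). Then for every x ∈ ℝ^N, (Π_{1≤i<j≤N} (x_j − x_i))² · Π_{k=1}^N e^{−N·V(x_k)} = (Π_{k=0}^{N−1} c_k²) · det((K_N(x_i, x_j))_{1≤i,j≤N}). -/
open Finset

/-- With `φ_k(s) = c_k⁻¹ e^{−N V(s)/2} π_k(s)` and kernel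
`K_N(r,s) = Σ_k φ_k(r) φ_k(s)`, the weighted squared Vandermonde factorizes as
`Δ(x)²·Π_k e^{−N V(x_k)} = (Π_k c_k²)·det(K_N(x_i,x_j))`. -/
theorem stmt_15 (N : ℕ) (hN : 1 ≤ N) (V : ℝ → ℝ)
    (p : Fin N → Polynomial ℝ)
    (hmonic : ∀ k, (p k).Monic) (hdeg : ∀ k : Fin N, (p k).natDegree = k)
    (c : Fin N → ℝ) (hc : ∀ k, 0 < c k)
    (φ : Fin N → ℝ → ℝ)
    (hφ : ∀ k s, φ k s = (c k)⁻¹ * Real.exp (-(N * V s) / 2) * (p k).eval s)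
    (K : ℝ → ℝ → ℝ) (hK : ∀ r s, K r s = ∑ k, φ k r * φ k s)
    (x : Fin N → ℝ) :
    (∏ i, ∏ j ∈ Finset.Ioi i, (x j - x i)) ^ 2 * ∏ k, Real.exp (-(N * V (x k))) =
      (∏ k, (c k) ^ 2) *
        Matrix.det (Matrix.of fun i j : Fin N => K (x i) (x j)) := by
  set A : Matrix (Fin N) (Fin N) ℝ := Matrix.of fun i k => φ k (x i) with hA
  have hKA : (Matrix.of fun i j : Fin N => K (x i) (x j)) = A * A.transpose := by
    ext i j
    simp [hA, hK, Matrix.mul_apply]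
  have hdetA : A.det = (∏ k, Real.exp (-(N * V (x k)) / 2)) * ((∏ k, (c k)⁻¹) *
      ∏ i, ∏ j ∈ Finset.Ioi i, (x j - x i)) := by
    rw [← Matrix.det_vandermonde,
      Matrix.det_eval_matrixOfPolynomials_eq_det_vandermonde x p hdeg hmonic,
      ← Matrix.det_mul_row, ← Matrix.det_mul_column]
    congr 1
    ext i k
    simp only [hA, hφ, Matrix.of_apply]
    ring
  have hexp : (∏ k, Real.exp (-(N * V (x k)) / 2)) ^ 2 = ∏ k, Real.exp (-(N * V (x k))) := by
    rw [← Finset.prod_pow]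
    refine Finset.prod_congr rfl fun k _ => ?_
    rw [← Real.exp_nat_mul]
    congr 1
    push_cast
    ring
  have hc0 : ∏ k, c k ≠ 0 := Finset.prod_ne_zero_iff.mpr fun k _ => (hc k).ne'
  rw [hKA, Matrix.det_mul, Matrix.det_transpose, hdetA, ← hexp, Finset.prod_pow,
    Finset.prod_inv_distrib]
  field_simp
end

section
/- Let N ≥ 1, let V : ℝ → ℝ be measurable such that s ↦ p(s)·e^{−N·V(s)} is integrable for every polynomial p, and let π_0, ..., π_{N−1} be the monic orthogonal polynomials for the weight e^{−N·V(s)} ds (deg π_k = k and ∫ π_j(s)·π_k(s)·e^{−N·V(s)} ds = 0 for j ≠ k), with c_k² = ∫ π_k(s)²·e^{−N·V(s)} ds. Then ∫_{ℝ^N} (Π_{1≤i<j≤N} (x_j − x_i))² · Π_{k=1}^N e^{−N·V(x_k)} dx = N! · Π_{k=0}^{N−1} c_k². -/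
open Finset MeasureTheory

/-- **Andréief's identity**: the integral of a product of two determinants is a determinant of
integrals. -/
theorem integral_det_mul_det {ι E 𝕜 : Type*} [Fintype ι] [DecidableEq ι] [RCLike 𝕜]
    [MeasurableSpace E] (μ : Measure E) [SigmaFinite μ] (f g : ι → E → 𝕜)
    (hfg : ∀ i j, Integrable (fun s => f i s * g j s) μ) :
    ∫ x : ι → E, (Matrix.of fun i j => f i (x j)).det * (Matrix.of fun i j => g i (x j)).det
        ∂Measure.pi (fun _ => μ) =
      (Fintype.card ι).factorial * (Matrix.of fun i j => ∫ s, f i s * g j s ∂μ).det := by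
  set A : Matrix ι ι 𝕜 := Matrix.of fun i j => ∫ s, f i s * g j s ∂μ with hA
  have expand : ∀ x : ι → E,
      (Matrix.of fun i j => f i (x j)).det * (Matrix.of fun i j => g i (x j)).det =
        ∑ σ : Equiv.Perm ι, ∑ τ : Equiv.Perm ι,
          ((σ.sign : ℤ) : 𝕜) * ((τ.sign : ℤ) : 𝕜) * ∏ i, f (σ i) (x i) * g (τ i) (x i) := by
    intro x
    simp_rw [Matrix.det_apply', Matrix.of_apply, Finset.sum_mul_sum, Finset.prod_mul_distrib]
    exact Finset.sum_congr rfl fun σ _ => Finset.sum_congr rfl fun τ _ => by ring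
  have integrable_term : ∀ σ τ : Equiv.Perm ι, Integrable (fun x : ι → E =>
      ((σ.sign : ℤ) : 𝕜) * ((τ.sign : ℤ) : 𝕜) * ∏ i, f (σ i) (x i) * g (τ i) (x i))
      (Measure.pi fun _ => μ) := fun σ τ =>
    (Integrable.fintype_prod (f := fun i s => f (σ i) s * g (τ i) s)
      fun i => hfg (σ i) (τ i)).const_mul _
  have inner_sum : ∀ σ : Equiv.Perm ι, ∑ τ : Equiv.Perm ι,
      ((σ.sign : ℤ) : 𝕜) * ((τ.sign : ℤ) : 𝕜) * ∏ i, A (σ i) (τ i) = A.det := by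
    intro σ
    have h : ∑ τ : Equiv.Perm ι, ((τ.sign : ℤ) : 𝕜) * ∏ i, A (σ i) (τ i) =
        ((σ.sign : ℤ) : 𝕜) * A.det := by
      rw [← Matrix.det_permute σ A, ← Matrix.det_transpose, Matrix.det_apply']
      rfl
    simp_rw [mul_assoc]
    rw [← Finset.mul_sum, h, ← mul_assoc, ← Int.cast_mul, Int.units_coe_mul_self, Int.cast_one,
      one_mul]
  simp_rw [expand]
  rw [integral_finsetSum _ fun σ _ => integrable_finsetSum _ fun τ _ => integrable_term σ τ]
  calc _ = ∑ _σ : Equiv.Perm ι, A.det := Finset.sum_congr rfl fun σ _ => by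
        rw [integral_finsetSum _ fun τ _ => integrable_term σ τ, ← inner_sum σ]
        refine Finset.sum_congr rfl fun τ _ => ?_
        rw [integral_const_mul,
          integral_fintype_prod_eq_prod (f := fun i s => f (σ i) s * g (τ i) s)]
        rfl
    _ = _ := by simp [Fintype.card_perm]

/-- The determinant of the values of monic polynomials of degrees `0, …, n - 1` is the Vandermonde
product. -/
theorem det_eval_monic_eq_prod_sub {R : Type*} [CommRing R] {n : ℕ} (p : Fin n → Polynomial R)
    (hdeg : ∀ i, (p i).natDegree = i) (hmonic : ∀ i, (p i).Monic) (x : Fin n → R) :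
    (Matrix.of fun i j => (p i).eval (x j)).det = ∏ i, ∏ j ∈ Finset.Ioi i, (x j - x i) := by
  rw [← Matrix.det_vandermonde,
    Matrix.det_eval_matrixOfPolynomials_eq_det_vandermonde x p hdeg hmonic,
    ← Matrix.det_transpose]
  rfl

/-- Normalization of the joint eigenvalue density: if `π_0, …, π_{N−1}` are the monic
orthogonal polynomials for the weight `e^{−N V(s)} ds` with squared norms `c_k²`, then
`∫_{ℝ^N} Δ(x)²·Π_k e^{−N V(x_k)} dx = N!·Π_k c_k²`. -/
theorem stmt_16 (N : ℕ) (hN : 1 ≤ N) (V : ℝ → ℝ) (hV : Measurable V)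
    (hint : ∀ q : Polynomial ℝ,
      Integrable (fun s : ℝ => q.eval s * Real.exp (-(N * V s))))
    (p : Fin N → Polynomial ℝ)
    (hmonic : ∀ k, (p k).Monic) (hdeg : ∀ k : Fin N, (p k).natDegree = k)
    (horth : ∀ j k, j ≠ k →
      ∫ s : ℝ, (p j).eval s * (p k).eval s * Real.exp (-(N * V s)) = 0)
    (c : Fin N → ℝ)
    (hc : ∀ k, (c k) ^ 2 = ∫ s : ℝ, ((p k).eval s) ^ 2 * Real.exp (-(N * V s))) :
    ∫ x : Fin N → ℝ,
        (∏ i, ∏ j ∈ Finset.Ioi i, (x j - x i)) ^ 2 *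
          ∏ k, Real.exp (-(N * V (x k))) =
      (N.factorial : ℝ) * ∏ k, (c k) ^ 2 := by
  set w : ℝ → ℝ := fun s => Real.exp (-(N * V s)) with hw
  have hfg : ∀ i j, Integrable (fun s => ((p i).eval s * w s) * (p j).eval s) := fun i j =>
    (hint (p i * p j)).congr (.of_forall fun s => by simp only [Polynomial.eval_mul, hw]; ring)
  have hdiag : (Matrix.of fun i j => ∫ s, ((p i).eval s * w s) * (p j).eval s) =
      Matrix.diagonal fun k => (c k) ^ 2 := by
    ext i j
    rcases eq_or_ne i j with rfl | hij
    · rw [Matrix.diagonal_apply_eq, hc, Matrix.of_apply]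
      exact integral_congr_ae (.of_forall fun s => by simp only [hw]; ring)
    · rw [Matrix.diagonal_apply_ne _ hij, ← horth i j hij, Matrix.of_apply]
      exact integral_congr_ae (.of_forall fun s => by simp only [hw]; ring)
  have key := integral_det_mul_det volume (fun i s => (p i).eval s * w s)
    (fun i s => (p i).eval s) hfg
  rw [hdiag, Matrix.det_diagonal, Fintype.card_fin] at key
  rw [← key, volume_pi]
  refine integral_congr_ae (.of_forall fun x => ?_)
  have hdet : (Matrix.of fun i j => (p i).eval (x j) * w (x j)).det =
      (∏ k, w (x k)) * (Matrix.of fun i j => (p i).eval (x j)).det := by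
    rw [← Matrix.det_mul_row]
    simp only [Matrix.of_apply, mul_comm]
  simp only [hdet, det_eval_monic_eq_prod_sub p hdeg hmonic x]
  simp only [hw]
  ring
end
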